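/- Let τ = t + is with t, s orthonormal unit vectors in ℝ^m. For natural numbers k ≠ ℓ, ∫_{S^{m-1}} ⟨ω,τ†⟩^k ⟨ω,τ⟩^ℓ ω τ τ† ω dS(ω) = 0, and for k = ℓ: ∫_{S^{m-1}} ⟨ω,τ†⟩^k ⟨ω,τ⟩^k ω τ τ† ω dS(ω) = (-1)^k π^{m/2} (k!/Γ(k+1+m/2)) (4 τ∧τ† - m τ τ† - 2k τ† τ). -/

import Mathlib

open MeasureTheory

/-- The complex Clifford algebra `ℂ_m`: Clifford algebra of `v ↦ -∑ vⱼ²` on `ℂ^m`. -/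
noncomputable def Qf (m : ℕ) : QuadraticForm ℂ (Fin m → ℂ) :=
  QuadraticMap.weightedSumSquares ℂ (fun _ : Fin m => (-1 : ℂ))


lemma aux_radial (n d : ℕ) :
    ∫ r : Set.Ioi (0:ℝ), (((r:ℝ):ℂ) ^ d * (Real.exp (-(r:ℝ)^2) : ℂ)) ∂(Measure.volumeIoiPow n)
      = ((Real.Gamma (((d + n + 1 : ℕ) : ℝ) / 2) / 2 : ℝ) : ℂ) := by
  simp only [Measure.volumeIoiPow, ENNReal.ofReal]
  rw [integral_withDensity_eq_integral_smul,
    integral_subtype_comap measurableSet_Ioi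
      fun a : ℝ ↦ Real.toNNReal (a ^ n) • (((a:ℝ):ℂ) ^ d * (Real.exp (-(a:ℝ)^2) : ℂ))]
  · have h := integral_rpow_mul_exp_neg_rpow (p := 2) (q := ((d + n : ℕ) : ℝ)) (by norm_num)
      (by have : (0:ℝ) ≤ ((d + n : ℕ) : ℝ) := Nat.cast_nonneg _
          linarith)
    have h2 : ((((d + n : ℕ) : ℝ) + 1) / 2) = (((d + n + 1 : ℕ) : ℝ) / 2) := by push_cast; ring
    rw [h2] at h
    have h3 : Real.Gamma (((d + n + 1 : ℕ) : ℝ) / 2) / 2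
        = 1 / 2 * Real.Gamma (((d + n + 1 : ℕ) : ℝ) / 2) := by ring
    rw [h3, ← h, ← integral_complex_ofReal]
    refine setIntegral_congr_fun measurableSet_Ioi fun x hx ↦ ?_
    have hx0 : (0:ℝ) < x := hx
    simp only [NNReal.smul_def, Real.coe_toNNReal _ (pow_nonneg hx0.le _), Complex.real_smul]
    rw [Real.rpow_natCast, Real.rpow_ofNat]
    push_cast
    ring
  · exact (measurable_subtype_coe.pow_const _).real_toNNReal

lemma aux_polar {E : Type*} [NormedAddCommGroup E] [InnerProductSpace ℝ E] [FiniteDimensional ℝ E]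
    [MeasurableSpace E] [BorelSpace E] [Nontrivial E] (f : E → ℂ) (d : ℕ)
    (hf : ∀ (r : ℝ) (x : E), 0 < r → f (r • x) = (r : ℂ) ^ d * f x) :
    ∫ x : E, f x * (Real.exp (-‖x‖ ^ 2) : ℂ) =
      (∫ ω : Metric.sphere (0 : E) 1, f ω ∂((volume : Measure E).toSphere)) *
        ((Real.Gamma (((d + Module.finrank ℝ E : ℕ) : ℝ) / 2) / 2 : ℝ) : ℂ) := by
  have hpos : 0 < Module.finrank ℝ E := Module.finrank_pos
  have hr := aux_radial (Module.finrank ℝ E - 1) d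
  rw [show d + (Module.finrank ℝ E - 1) + 1 = d + Module.finrank ℝ E by omega] at hr
  rw [← hr, ← integral_prod_mul]
  rw [← (volume : Measure E).measurePreserving_homeomorphUnitSphereProd.integral_comp
    (Homeomorph.measurableEmbedding _)]
  rw [← restrict_compl_singleton (μ := (volume : Measure E)) 0,
    ← integral_subtype_comap (measurableSet_singleton _).compl
      (fun x : E => f x * (Real.exp (-‖x‖ ^ 2) : ℂ)), restrict_compl_singleton]
  refine integral_congr_ae (.of_forall fun x => ?_)
  have hx : (0:ℝ) < ‖(x:E)‖ := norm_pos_iff.2 x.2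
  simp only [homeomorphUnitSphereProd_apply_snd_coe, homeomorphUnitSphereProd_apply_fst_coe]
  rw [hf _ _ (inv_pos.2 hx)]
  have : ((‖(x:E)‖ : ℝ) : ℂ) ≠ 0 := by exact_mod_cast hx.ne'
  rw [Complex.ofReal_inv, inv_pow]
  field_simp

lemma aux_split {E : Type*} [NormedAddCommGroup E] [InnerProductSpace ℝ E] [FiniteDimensional ℝ E]
    [MeasurableSpace E] [BorelSpace E] {n : ℕ} (b : OrthonormalBasis (Fin 2 ⊕ Fin n) ℝ E)
    (f : ℂ → ℂ) (g : (Fin n → ℝ) → ℂ) :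
    ∫ x : E, f ⟨b.repr x (.inl 0), b.repr x (.inl 1)⟩ * g (fun i => b.repr x (.inr i))
        * (Real.exp (-‖x‖ ^ 2) : ℂ) =
      (∫ z : ℂ, f z * (Real.exp (-‖z‖ ^ 2) : ℂ)) *
        ∫ q : Fin n → ℝ, g q * (Real.exp (-∑ i, q i ^ 2) : ℂ) := by
  rw [← integral_prod_mul]
  have mp := ((((Complex.volume_preserving_equiv_pi.symm.prod
    (MeasurePreserving.id (volume : Measure (Fin n → ℝ))))).comp
    (volume_measurePreserving_sumPiEquivProdPi (fun _ : Fin 2 ⊕ Fin n => ℝ))).comp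
    (EuclideanSpace.volume_preserving_symm_measurableEquiv_toLp (Fin 2 ⊕ Fin n))).comp
    b.measurePreserving_measurableEquiv
  have emb : MeasurableEmbedding ((((Prod.map Complex.measurableEquivPi.symm id) ∘
    (MeasurableEquiv.sumPiEquivProdPi (fun _ : Fin 2 ⊕ Fin n => ℝ))) ∘
    (MeasurableEquiv.toLp 2 (Fin 2 ⊕ Fin n → ℝ)).symm) ∘ b.measurableEquiv) :=
    ((((Complex.measurableEquivPi.symm.prodCongr (MeasurableEquiv.refl _)).measurableEmbedding).comp
      (MeasurableEquiv.measurableEmbedding _)).comp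
      (MeasurableEquiv.measurableEmbedding _)).comp (MeasurableEquiv.measurableEmbedding _)
  have := mp.integral_comp emb (fun z : ℂ × (Fin n → ℝ) => f z.1 * (Real.exp (-‖z.1‖ ^ 2) : ℂ)
    * (g z.2 * (Real.exp (-∑ i, z.2 i ^ 2) : ℂ)))
  refine Eq.trans ?_ this
  refine integral_congr_ae (.of_forall fun x => ?_)
  have e1 : (((((Prod.map Complex.measurableEquivPi.symm id) ∘
    (MeasurableEquiv.sumPiEquivProdPi (fun _ : Fin 2 ⊕ Fin n => ℝ))) ∘
    (MeasurableEquiv.toLp 2 (Fin 2 ⊕ Fin n → ℝ)).symm) ∘ b.measurableEquiv) x)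
    = ((⟨b.repr x (.inl 0), b.repr x (.inl 1)⟩ : ℂ), fun i => b.repr x (.inr i)) := by
    refine Prod.ext ?_ ?_
    · apply Complex.ext <;> simp [MeasurableEquiv.sumPiEquivProdPi, OrthonormalBasis.measurableEquiv, Equiv.sumPiEquivProdPi]
    · rfl
  simp only [e1]
  have e2 : ‖x‖ ^ 2 = ‖(⟨b.repr x (.inl 0), b.repr x (.inl 1)⟩ : ℂ)‖ ^ 2
      + ∑ i, (b.repr x (.inr i)) ^ 2 := by
    rw [← b.repr.norm_map, EuclideanSpace.norm_sq_eq, Complex.sq_norm, Complex.normSq_mk]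
    simp [pow_two]
  rw [e2, neg_add, Real.exp_add]
  push_cast
  ring

lemma aux_gauss_n (n : ℕ) :
    ∫ q : Fin n → ℝ, (1:ℂ) * (Real.exp (-∑ i, q i ^ 2) : ℂ) = ((Real.pi ^ ((n:ℝ)/2) : ℝ) : ℂ) := by
  simp only [one_mul]
  rw [integral_complex_ofReal]
  congr 1
  have := integral_fintype_prod_volume_eq_pow (ι := Fin n) (fun x : ℝ => Real.exp (-1 * x ^ 2))
  rw [integral_gaussian] at this
  simp only [← Real.exp_sum, Fintype.card_fin, ← Finset.mul_sum, div_one] at this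
  simp only [neg_one_mul] at this
  rw [this, Real.sqrt_eq_rpow, ← Real.rpow_natCast, ← Real.rpow_mul Real.pi_pos.le]
  congr 1; ring

lemma aux_gauss_odd (n : ℕ) (i : Fin n) :
    ∫ q : Fin n → ℝ, (q i : ℂ) * (Real.exp (-∑ i, q i ^ 2) : ℂ) = 0 := by
  have h := integral_neg_eq_self (fun q : Fin n → ℝ => (q i : ℂ) * (Real.exp (-∑ i, q i ^ 2) : ℂ)) volume
  simp only [Pi.neg_apply, Complex.ofReal_neg, neg_sq, neg_mul, integral_neg] at h
  exact self_eq_neg.1 (by simpa using h.symm)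

lemma aux_gauss_C (k : ℕ) :
    ∫ z : ℂ, ((-(starRingEnd ℂ) z) ^ k * z ^ k) * (Real.exp (-‖z‖ ^ 2) : ℂ)
      = (-1) ^ k * ((Real.pi * (Nat.factorial k : ℝ) : ℝ) : ℂ) := by
  have h := Complex.integral_rpow_mul_exp_neg_rpow (p := 2) (q := ((2 * k : ℕ) : ℝ)) (by norm_num)
      (by have : (0:ℝ) ≤ ((2 * k : ℕ) : ℝ) := Nat.cast_nonneg _
          linarith)
  have h2 : (((2 * k : ℕ) : ℝ) + 2) / 2 = (k : ℝ) + 1 := by push_cast; ring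
  rw [h2, Real.Gamma_nat_eq_factorial] at h
  have h3 : 2 * Real.pi / 2 * (Nat.factorial k : ℝ) = Real.pi * (Nat.factorial k : ℝ) := by ring
  rw [← h3, ← h, ← integral_complex_ofReal, ← integral_const_mul]
  refine integral_congr_ae (.of_forall fun z => ?_)
  simp only
  rw [neg_pow, mul_assoc ((-1 : ℂ) ^ k), ← mul_pow, Complex.conj_mul', Real.rpow_natCast,
    Real.rpow_ofNat]
  push_cast
  ring

lemma aux_gauss_C_ne (p q : ℕ) (hpq : p ≠ q) :
    ∫ z : ℂ, ((-(starRingEnd ℂ) z) ^ p * z ^ q) * (Real.exp (-‖z‖ ^ 2) : ℂ) = 0 := by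
  have hne : ((q : ℂ) - p) ≠ 0 := sub_ne_zero.2 (by exact_mod_cast hpq.symm)
  set θ : ℝ := Real.pi / ((q:ℝ) - p) with hθ
  have hc : (Circle.exp θ : ℂ) = Complex.exp (θ * Complex.I) := Circle.coe_exp θ
  have hkey : (starRingEnd ℂ (Circle.exp θ : ℂ)) ^ p * (Circle.exp θ : ℂ) ^ q = -1 := by
    rw [hc, ← Complex.exp_conj, ← Complex.exp_nat_mul, ← Complex.exp_nat_mul, ← Complex.exp_add,
      ← Complex.exp_pi_mul_I]
    congr 1
    simp only [map_mul, Complex.conj_ofReal, Complex.conj_I, hθ]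
    push_cast
    field_simp
    ring
  have h := (LinearIsometryEquiv.measurePreserving (rotation (Circle.exp θ))).integral_comp
    (rotation (Circle.exp θ)).toHomeomorph.measurableEmbedding
    (fun z : ℂ => ((-(starRingEnd ℂ) z) ^ p * z ^ q) * (Real.exp (-‖z‖ ^ 2) : ℂ))
  have h2 : ∀ z : ℂ, ((-(starRingEnd ℂ) (rotation (Circle.exp θ) z)) ^ p *
      (rotation (Circle.exp θ) z) ^ q) * (Real.exp (-‖rotation (Circle.exp θ) z‖ ^ 2) : ℂ)
      = - (((-(starRingEnd ℂ) z) ^ p * z ^ q) * (Real.exp (-‖z‖ ^ 2) : ℂ)) := by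
    intro z
    rw [LinearIsometryEquiv.norm_map, rotation_apply, map_mul, ← mul_neg, mul_pow, mul_pow]
    linear_combination (((-(starRingEnd ℂ) z) ^ p * z ^ q) * (Real.exp (-‖z‖ ^ 2) : ℂ)) * hkey
  simp only [h2, integral_neg] at h
  exact self_eq_neg.1 h.symm

section sphere
set_option linter.unusedSectionVars false
variable {E : Type*} [NormedAddCommGroup E] [InnerProductSpace ℝ E] [FiniteDimensional ℝ E]
    [MeasurableSpace E] [BorelSpace E] {n : ℕ} (b : OrthonormalBasis (Fin 2 ⊕ Fin n) ℝ E)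

/-- the complex coordinate in the plane of the first two basis vectors -/
noncomputable def zc (x : E) : ℂ := ⟨b.repr x (.inl 0), b.repr x (.inl 1)⟩

lemma zc_smul (r : ℝ) (x : E) : zc b (r • x) = (r : ℂ) * zc b x := by
  apply Complex.ext <;> simp [zc]

lemma continuous_zc : Continuous (zc b) := by
  have h : zc b = fun x => ((b.repr x (.inl 0) : ℝ) : ℂ) + (b.repr x (.inl 1) : ℝ) * Complex.I := by
    funext x
    apply Complex.ext <;> simp [zc]
  rw [h]
  have h0 : ∀ i, Continuous fun x => b.repr x i := fun i =>
    (EuclideanSpace.proj i : EuclideanSpace ℝ (Fin 2 ⊕ Fin n) →L[ℝ] ℝ).continuous.comp b.repr.continuous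
  have h1 := h0 (.inl 0)
  have h2 := h0 (.inl 1)
  fun_prop

lemma sph_finrank {E : Type*} [NormedAddCommGroup E] [InnerProductSpace ℝ E] {n : ℕ}
    (b : OrthonormalBasis (Fin 2 ⊕ Fin n) ℝ E) : Module.finrank ℝ E = n + 2 := by
  rw [Module.finrank_eq_card_basis b.toBasis]; simp; ring

lemma sph_nontrivial {E : Type*} [NormedAddCommGroup E] [InnerProductSpace ℝ E] {n : ℕ}
    (b : OrthonormalBasis (Fin 2 ⊕ Fin n) ℝ E) : Nontrivial E := by
  apply Module.nontrivial_of_finrank_pos (R := ℝ)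
  rw [sph_finrank b]; omega

lemma sph_K_ne (p q : ℕ) (hpq : p ≠ q) :
    ∫ ω : Metric.sphere (0 : E) 1, (-(starRingEnd ℂ) (zc b ω)) ^ p * (zc b ω) ^ q
      ∂((volume : Measure E).toSphere) = 0 := by
  have := sph_nontrivial b
  have h := aux_polar (fun x : E => (-(starRingEnd ℂ) (zc b x)) ^ p * (zc b x) ^ q) (p + q) (by
    intro r x _
    simp only [zc_smul, map_mul, Complex.conj_ofReal, ← mul_neg, mul_pow, pow_add]
    ring)
  have h2 := aux_split b (fun z => (-(starRingEnd ℂ) z) ^ p * z ^ q) (fun _ => 1)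
  rw [aux_gauss_C_ne p q hpq, zero_mul] at h2
  simp only [mul_one] at h2
  rw [show (∫ x : E, (-(starRingEnd ℂ) (zc b x)) ^ p * (zc b x) ^ q * (Real.exp (-‖x‖ ^ 2) : ℂ)) = 0
    from h2] at h
  refine (mul_eq_zero.1 h.symm).resolve_right ?_
  rw [sph_finrank b, ← ne_eq, Complex.ofReal_ne_zero]
  have : 0 < Real.Gamma (((p + q + (n + 2) : ℕ) : ℝ) / 2) := Real.Gamma_pos_of_pos (by positivity)
  positivity

lemma sph_T (p q : ℕ) (i : Fin n) :
    ∫ ω : Metric.sphere (0 : E) 1, (-(starRingEnd ℂ) (zc b ω)) ^ p * (zc b ω) ^ q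
      * (b.repr (ω : E) (.inr i) : ℂ)
      ∂((volume : Measure E).toSphere) = 0 := by
  have := sph_nontrivial b
  have h := aux_polar (fun x : E => (-(starRingEnd ℂ) (zc b x)) ^ p * (zc b x) ^ q
      * (b.repr (x : E) (.inr i) : ℂ)) (p + q + 1) (by
    intro r x _
    simp only [zc_smul, map_mul, Complex.conj_ofReal, ← mul_neg, mul_pow, pow_add, map_smul,
      PiLp.smul_apply, smul_eq_mul, Complex.ofReal_mul]
    ring)
  have h2 := aux_split b (fun z => (-(starRingEnd ℂ) z) ^ p * z ^ q) (fun q => (q i : ℂ))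
  rw [aux_gauss_odd, mul_zero] at h2
  rw [show (∫ x : E, (-(starRingEnd ℂ) (zc b x)) ^ p * (zc b x) ^ q
      * (b.repr (x : E) (.inr i) : ℂ) * (Real.exp (-‖x‖ ^ 2) : ℂ)) = 0
    from h2] at h
  refine (mul_eq_zero.1 h.symm).resolve_right ?_
  rw [sph_finrank b, ← ne_eq, Complex.ofReal_ne_zero]
  have : 0 < Real.Gamma (((p + q + 1 + (n + 2) : ℕ) : ℝ) / 2) :=
    Real.Gamma_pos_of_pos (by positivity)
  positivity

lemma sph_K (k : ℕ) :
    ∫ ω : Metric.sphere (0 : E) 1, (-(starRingEnd ℂ) (zc b ω)) ^ k * (zc b ω) ^ k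
      ∂((volume : Measure E).toSphere) =
      (-1) ^ k * ((2 * Real.pi ^ (((n + 2 : ℕ) : ℝ) / 2) * (Nat.factorial k : ℝ)
        / Real.Gamma (k + ((n + 2 : ℕ) : ℝ) / 2) : ℝ) : ℂ) := by
  have := sph_nontrivial b
  have h := aux_polar (fun x : E => (-(starRingEnd ℂ) (zc b x)) ^ k * (zc b x) ^ k) (k + k) (by
    intro r x _
    simp only [zc_smul, map_mul, Complex.conj_ofReal, ← mul_neg, mul_pow, pow_add]
    ring)
  have h2 := aux_split b (fun z => (-(starRingEnd ℂ) z) ^ k * z ^ k) (fun _ => 1)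
  rw [aux_gauss_C k, aux_gauss_n] at h2
  simp only [mul_one] at h2
  have h3 := h.symm.trans h2
  rw [sph_finrank b] at h3
  have e : ((k + k + (n + 2) : ℕ) : ℝ) / 2 = k + ((n + 2 : ℕ) : ℝ) / 2 := by push_cast; ring
  rw [e] at h3
  have hG : 0 < Real.Gamma (k + ((n + 2 : ℕ) : ℝ) / 2) := Real.Gamma_pos_of_pos (by positivity)
  have hG' : ((Real.Gamma (k + ((n + 2 : ℕ) : ℝ) / 2) : ℝ) : ℂ) ≠ 0 := by exact_mod_cast hG.ne'
  have e2 : Real.pi ^ (((n + 2 : ℕ) : ℝ) / 2) = Real.pi * Real.pi ^ ((n : ℝ) / 2) := by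
    rw [show ((n + 2 : ℕ) : ℝ) / 2 = 1 + (n : ℝ) / 2 by push_cast; ring,
      Real.rpow_add Real.pi_pos, Real.rpow_one]
  rw [e2]
  generalize Real.Gamma (k + ((n + 2 : ℕ) : ℝ) / 2) = G at *
  rw [Complex.ofReal_div] at h3 ⊢
  rw [mul_div_assoc', eq_div_iff hG']
  rw [mul_div_assoc', div_eq_iff (by norm_num)] at h3
  rw [h3]
  push_cast
  ring

end sphere

lemma Qf_sq (m : ℕ) (x : Fin m → ℂ) : CliffordAlgebra.ι (Qf m) x * CliffordAlgebra.ι (Qf m) x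
    = (-∑ j, x j * x j) • (1 : CliffordAlgebra (Qf m)) := by
  rw [CliffordAlgebra.ι_sq_scalar, Algebra.algebraMap_eq_smul_one]
  simp [Qf, QuadraticMap.weightedSumSquares_apply]

lemma Qf_swap (m : ℕ) (x y : Fin m → ℂ) :
    CliffordAlgebra.ι (Qf m) x * CliffordAlgebra.ι (Qf m) y
    = (-2 * ∑ j, x j * y j) • (1 : CliffordAlgebra (Qf m))
      - CliffordAlgebra.ι (Qf m) y * CliffordAlgebra.ι (Qf m) x := by
  have h := Qf_sq m (x + y)
  have hs : (-∑ j, (x + y) j * (x + y) j) = (-∑ j, x j * x j) + (-∑ j, y j * y j)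
      + (-2 * ∑ j, x j * y j) := by
    simp only [Pi.add_apply, Finset.mul_sum, ← Finset.sum_neg_distrib, ← Finset.sum_add_distrib]
    refine Finset.sum_congr rfl fun j _ => ?_
    ring
  rw [hs, add_smul, add_smul, ← Qf_sq, ← Qf_sq, map_add, mul_add, add_mul, add_mul] at h
  rw [eq_sub_iff_add_eq]
  generalize (-2 * ∑ j, x j * y j) • (1 : CliffordAlgebra (Qf m)) = c at *
  have := sub_eq_zero.2 h
  rw [← sub_eq_zero, ← this]
  abel

lemma Qf_basis (m : ℕ) (x : Fin m → ℂ) : CliffordAlgebra.ι (Qf m) x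
    = ∑ i, x i • CliffordAlgebra.ι (Qf m) (Pi.single i 1) := by
  conv_lhs => rw [pi_eq_sum_univ' x]
  simp only [map_sum, map_smul]

lemma Qf_wedge (m : ℕ) (x y : Fin m → ℂ) :
    (2 : ℂ) • (∑ i, ∑ j, if i < j then (x i * y j - x j * y i) •
      (CliffordAlgebra.ι (Qf m) (Pi.single i 1) * CliffordAlgebra.ι (Qf m) (Pi.single j 1)) else 0)
    = CliffordAlgebra.ι (Qf m) x * CliffordAlgebra.ι (Qf m) y
      - CliffordAlgebra.ι (Qf m) y * CliffordAlgebra.ι (Qf m) x := by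
  set e : Fin m → CliffordAlgebra (Qf m) := fun i => CliffordAlgebra.ι (Qf m) (Pi.single i 1) with he
  have hanti : ∀ i j, i ≠ j → e i * e j = - (e j * e i) := by
    intro i j hij
    have := Qf_swap m (Pi.single i 1) (Pi.single j 1)
    have h0 : ∑ l, (Pi.single i (1:ℂ) : Fin m → ℂ) l * (Pi.single j (1:ℂ) : Fin m → ℂ) l = 0 := by
      simp [Pi.single_apply, hij.symm]
    rw [h0] at this
    simpa [he] using this
  have hL : CliffordAlgebra.ι (Qf m) x * CliffordAlgebra.ι (Qf m) y
      - CliffordAlgebra.ι (Qf m) y * CliffordAlgebra.ι (Qf m) x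
      = ∑ i, ∑ j, (x i * y j - x j * y i) • (e i * e j) := by
    rw [Qf_basis m x, Qf_basis m y]
    simp only [Finset.sum_mul_sum, smul_mul_smul_comm, ← Finset.sum_sub_distrib]
    refine Finset.sum_congr rfl fun i _ => Finset.sum_congr rfl fun j _ => ?_
    rw [← sub_smul, mul_comm (y i)]
  have hsw : (∑ i, ∑ j, if i < j then (x i * y j - x j * y i) • (e i * e j) else 0)
      = ∑ i, ∑ j, if j < i then (x i * y j - x j * y i) • (e i * e j) else 0 := by
    rw [Finset.sum_comm]
    refine Finset.sum_congr rfl fun i _ => Finset.sum_congr rfl fun j _ => ?_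
    split_ifs with h
    · rw [hanti j i h.ne, smul_neg, ← neg_smul]
      congr 1; ring
    · rfl
  rw [hL, two_smul]
  nth_rw 2 [hsw]
  simp only [← Finset.sum_add_distrib]
  refine Finset.sum_congr rfl fun i _ => Finset.sum_congr rfl fun j _ => ?_
  rcases lt_trichotomy i j with h | h | h
  · simp [h, h.not_gt, he]
  · subst h; simp
  · simp [h, h.not_gt]

lemma Qf_pointwise (m : ℕ) (o x y : Fin m → ℂ) (ho : ∑ j, o j * o j = 1)
    (hx : ∑ j, x j * x j = 0) (hy : ∑ j, y j * y j = 0) {N : ℕ} (v : Fin N → ℂ)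
    (u : Fin N → Fin m → ℂ)
    (hdec : o = (-(1/2) * ∑ j, o j * x j) • y + (-(1/2) * ∑ j, o j * y j) • x + ∑ i, v i • u i) :
    CliffordAlgebra.ι (Qf m) o * CliffordAlgebra.ι (Qf m) x * CliffordAlgebra.ι (Qf m) y *
      CliffordAlgebra.ι (Qf m) o =
    (-1 - (∑ j, o j * y j) * (∑ j, o j * x j)) •
      (CliffordAlgebra.ι (Qf m) x * CliffordAlgebra.ι (Qf m) y)
    + ((∑ j, o j * y j) * (∑ j, o j * x j)) •
      (CliffordAlgebra.ι (Qf m) y * CliffordAlgebra.ι (Qf m) x)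
    + ∑ i, ((2 * (∑ j, o j * x j) * v i) • (CliffordAlgebra.ι (Qf m) (u i) * CliffordAlgebra.ι (Qf m) y)
       - (2 * (∑ j, o j * y j) * v i) • (CliffordAlgebra.ι (Qf m) (u i) * CliffordAlgebra.ι (Qf m) x)) := by
  have h1 := Qf_swap m o x
  have h2 := Qf_swap m y o
  have h3 := Qf_sq m o
  have h4 := Qf_sq m x
  have h5 := Qf_sq m y
  have h6 := congrArg (CliffordAlgebra.ι (Qf m)) hdec
  simp only [map_add, map_smul, map_sum] at h6
  rw [show ∑ j, y j * o j = ∑ j, o j * y j from Finset.sum_congr rfl fun _ _ => mul_comm _ _] at h2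
  rw [ho] at h3
  rw [hx, neg_zero, zero_smul] at h4
  rw [hy, neg_zero, zero_smul] at h5
  clear hdec ho hx hy
  generalize ∑ j, o j * x j = z at *
  generalize ∑ j, o j * y j = w at *
  generalize CliffordAlgebra.ι (Qf m) o = O at *
  generalize CliffordAlgebra.ι (Qf m) x = X at *
  generalize CliffordAlgebra.ι (Qf m) y = Y at *
  have hOY : O * Y = (-(1/2) * w) • (X * Y) + ∑ i, v i • (CliffordAlgebra.ι (Qf m) (u i) * Y) := by
    conv_lhs => rw [h6]
    simp only [add_mul, Finset.sum_mul, smul_mul_assoc, h5, smul_zero, zero_add]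
  have hOX : O * X = (-(1/2) * z) • (Y * X) + ∑ i, v i • (CliffordAlgebra.ι (Qf m) (u i) * X) := by
    conv_lhs => rw [h6]
    simp only [add_mul, Finset.sum_mul, smul_mul_assoc, h4, smul_zero, add_zero]
  have hmain : O * X * Y * O = (-1 : ℂ) • (X * Y) + (2 * z) • (O * Y) - (2 * w) • (O * X) := by
    have a1 : X * (O * O) * Y = (-1 : ℂ) • (X * Y) := by
      rw [h3]; simp
    calc O * X * Y * O = O * X * (Y * O) := by rw [mul_assoc]
      _ = (-2 * w) • (O * X) - O * X * O * Y := by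
        rw [h2, mul_sub, mul_smul_comm, mul_one, mul_assoc (O * X)]
      _ = (-2 * w) • (O * X) - ((-2 * z) • (O * Y) - X * (O * O) * Y) := by
        nth_rw 2 [h1]
        simp only [sub_mul, smul_mul_assoc, one_mul, mul_assoc]
      _ = _ := by
        rw [a1]
        module
  rw [hmain, hOY, hOX, Finset.sum_sub_distrib]
  simp only [mul_smul, ← Finset.smul_sum]
  module

lemma main_basis (n : ℕ) (t s : Fin (n + 2) → ℝ)
    (ht : ∑ j, t j ^ 2 = 1) (hs : ∑ j, s j ^ 2 = 1) (hts : ∑ j, t j * s j = 0) :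
    ∃ b : OrthonormalBasis (Fin 2 ⊕ Fin n) ℝ (EuclideanSpace ℝ (Fin (n + 2))),
      (∀ j, b (.inl 0) j = t j) ∧ (∀ j, b (.inl 1) j = s j) := by
  let v : Fin 2 ⊕ Fin n → EuclideanSpace ℝ (Fin (n + 2)) :=
    Sum.elim ![WithLp.toLp 2 t, WithLp.toLp 2 s] (fun _ => 0)
  have hst : ∑ j, s j * t j = 0 := by simpa only [mul_comm] using hts
  have hv : Orthonormal ℝ ((Set.range (Sum.inl : Fin 2 → Fin 2 ⊕ Fin n)).domRestrict v) := by
    rw [orthonormal_iff_ite]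
    rintro ⟨_, i, rfl⟩ ⟨_, j, rfl⟩
    fin_cases i <;> fin_cases j <;>
      simp [v, PiLp.inner_apply, ← pow_two, EuclideanSpace.norm_sq_eq, ht, hs, hts, hst,
        Set.domRestrict]
  obtain ⟨b, hb⟩ := hv.exists_orthonormalBasis_extension_of_card_eq (by simp; ring)
  refine ⟨b, fun j => ?_, fun j => ?_⟩
  · rw [hb _ ⟨0, rfl⟩]; simp [v]
  · rw [hb _ ⟨1, rfl⟩]; simp [v]

/-- Let `τ = t + is` with `t, s` orthonormal unit vectors of `ℝ^m`, `τ† = -t + is`.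
For naturals `k ≠ ℓ`, `∫_{S^{m-1}} ⟨ω,τ†⟩^k ⟨ω,τ⟩^ℓ ω τ τ† ω dS(ω) = 0`, and for `k = ℓ`,
`∫_{S^{m-1}} ⟨ω,τ†⟩^k ⟨ω,τ⟩^k ω τ τ† ω dS(ω)
  = (-1)^k π^{m/2} (k!/Γ(k+1+m/2)) (4 τ∧τ† - m τ τ† - 2k τ† τ)`,
where `τ∧τ† = ∑_{i<j} (τᵢτ†ⱼ - τⱼτ†ᵢ) eᵢeⱼ`.  The Clifford-algebra-valued integrals are
taken componentwise, i.e. after applying an arbitrary `ℂ`-linear functional. -/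
theorem sphere_integral_omega_tau_taud_omega (m : ℕ) (hm : 2 ≤ m) (t s : Fin m → ℝ)
    (ht : ∑ j, t j ^ 2 = 1) (hs : ∑ j, s j ^ 2 = 1) (hts : ∑ j, t j * s j = 0) :
    let τ : Fin m → ℂ := fun j => (t j : ℂ) + Complex.I * s j
    let τd : Fin m → ℂ := fun j => -(t j : ℂ) + Complex.I * s j
    let ι := CliffordAlgebra.ι (Qf m)
    let μ := (volume : Measure (EuclideanSpace ℝ (Fin m))).toSphere
    let wedge : CliffordAlgebra (Qf m) := ∑ i, ∑ j, if i < j then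
      (τ i * τd j - τ j * τd i) • (ι (Pi.single i 1) * ι (Pi.single j 1)) else 0
    ∀ φ : CliffordAlgebra (Qf m) →ₗ[ℂ] ℂ,
      (∀ k l : ℕ, k ≠ l →
        (∫ ω : Metric.sphere (0 : EuclideanSpace ℝ (Fin m)) 1,
          φ (((∑ j, ((ω : EuclideanSpace ℝ (Fin m)) j : ℂ) * τd j) ^ k *
              (∑ j, ((ω : EuclideanSpace ℝ (Fin m)) j : ℂ) * τ j) ^ l) •
            (ι (fun j => ((ω : EuclideanSpace ℝ (Fin m)) j : ℂ)) * ι τ * ι τd *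
              ι (fun j => ((ω : EuclideanSpace ℝ (Fin m)) j : ℂ)))) ∂μ) = 0) ∧
      (∀ k : ℕ,
        (∫ ω : Metric.sphere (0 : EuclideanSpace ℝ (Fin m)) 1,
          φ (((∑ j, ((ω : EuclideanSpace ℝ (Fin m)) j : ℂ) * τd j) ^ k *
              (∑ j, ((ω : EuclideanSpace ℝ (Fin m)) j : ℂ) * τ j) ^ k) •
            (ι (fun j => ((ω : EuclideanSpace ℝ (Fin m)) j : ℂ)) * ι τ * ι τd *
              ι (fun j => ((ω : EuclideanSpace ℝ (Fin m)) j : ℂ)))) ∂μ) =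
          φ (((-1 : ℂ) ^ k * ((Real.pi ^ ((m : ℝ) / 2) *
              ((Nat.factorial k : ℝ) / Real.Gamma (k + 1 + (m : ℝ) / 2)) : ℝ) : ℂ)) •
            ((4 : ℂ) • wedge - (m : ℂ) • (ι τ * ι τd) -
              ((2 * k : ℕ) : ℂ) • (ι τd * ι τ)))) := by
  
  intro τ τd ι μ wedge φ
  obtain ⟨n, rfl⟩ : ∃ n, m = n + 2 := ⟨m - 2, by omega⟩
  obtain ⟨b, hb0, hb1⟩ := main_basis n t s ht hs hts
  have htC : ∑ j, (t j : ℂ) ^ 2 = 1 := by exact_mod_cast congrArg (fun x : ℝ => (x : ℂ)) ht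
  have hsC : ∑ j, (s j : ℂ) ^ 2 = 1 := by exact_mod_cast congrArg (fun x : ℝ => (x : ℂ)) hs
  have htsC : ∑ j, (t j : ℂ) * s j = 0 := by exact_mod_cast congrArg (fun x : ℝ => (x : ℂ)) hts
  have hτ : ∑ j, τ j * τ j = 0 := by
    have : ∀ j, τ j * τ j = (t j : ℂ) ^ 2 + 2 * Complex.I * (t j * s j) - (s j : ℂ) ^ 2 := by
      intro j
      simp only [τ]
      linear_combination (s j : ℂ) ^ 2 * Complex.I_sq
    simp only [this, Finset.sum_sub_distrib, Finset.sum_add_distrib, ← Finset.mul_sum, htC, hsC,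
      htsC]
    ring
  have hτd : ∑ j, τd j * τd j = 0 := by
    have : ∀ j, τd j * τd j = (t j : ℂ) ^ 2 - 2 * Complex.I * (t j * s j) - (s j : ℂ) ^ 2 := by
      intro j
      simp only [τd]
      linear_combination (s j : ℂ) ^ 2 * Complex.I_sq
    simp only [this, Finset.sum_sub_distrib, ← Finset.mul_sum, htC, hsC, htsC]
    ring
  have hre : ∀ x : EuclideanSpace ℝ (Fin (n + 2)), b.repr x (.inl 0) = ∑ j, x j * t j := by
    intro x
    rw [b.repr_apply_apply, PiLp.inner_apply]
    simp [hb0, mul_comm]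
  have him : ∀ x : EuclideanSpace ℝ (Fin (n + 2)), b.repr x (.inl 1) = ∑ j, x j * s j := by
    intro x
    rw [b.repr_apply_apply, PiLp.inner_apply]
    simp [hb1, mul_comm]
  have hzc : ∀ x, zc b x = (b.repr x (.inl 0) : ℂ) + Complex.I * (b.repr x (.inl 1) : ℝ) := by
    intro x
    apply Complex.ext <;> simp [zc]
  have hz : ∀ x : EuclideanSpace ℝ (Fin (n + 2)), ∑ j, (x j : ℂ) * τ j = zc b x := by
    intro x
    rw [hzc, hre, him]
    push_cast
    simp only [Finset.mul_sum, ← Finset.sum_add_distrib, τ]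
    exact Finset.sum_congr rfl fun j _ => by ring
  have hw : ∀ x : EuclideanSpace ℝ (Fin (n + 2)), ∑ j, (x j : ℂ) * τd j
      = -(starRingEnd ℂ) (zc b x) := by
    intro x
    rw [hzc, hre, him]
    simp only [map_add, map_mul, Complex.conj_ofReal, Complex.conj_I]
    push_cast
    simp only [neg_add, neg_mul, neg_neg, ← Finset.sum_neg_distrib, Finset.mul_sum,
      ← Finset.sum_add_distrib, τd]
    exact Finset.sum_congr rfl fun j _ => by ring
  have hdec : ∀ x : EuclideanSpace ℝ (Fin (n + 2)), (fun j => (x j : ℂ)) =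
      (-(1/2) * ∑ j, (x j : ℂ) * τ j) • τd + (-(1/2) * ∑ j, (x j : ℂ) * τd j) • τ
        + ∑ i : Fin n, ((b.repr x (.inr i) : ℝ) : ℂ) • (fun j => (b (.inr i) j : ℂ)) := by
    intro x
    funext j
    have h := congrArg (fun y : EuclideanSpace ℝ (Fin (n + 2)) => ((y j : ℝ) : ℂ)) (b.sum_repr x)
    simp only [Fintype.sum_sum_type, Fin.sum_univ_two, PiLp.add_apply, PiLp.smul_apply,
      WithLp.ofLp_sum, Finset.sum_apply, smul_eq_mul, hb0, hb1] at h
    rw [← h, hz, hw, hzc]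
    simp only [map_add, map_mul, Complex.conj_ofReal, Complex.conj_I, Pi.add_apply, Pi.smul_apply,
      Finset.sum_apply, smul_eq_mul, τ, τd]
    push_cast
    linear_combination ((b.repr x (.inl 1) : ℂ) * s j) * Complex.I_sq
  have hsph : ∀ ω : Metric.sphere (0 : EuclideanSpace ℝ (Fin (n + 2))) 1,
      ∑ j, ((ω : EuclideanSpace ℝ (Fin (n + 2))) j : ℂ) *
        ((ω : EuclideanSpace ℝ (Fin (n + 2))) j : ℂ) = 1 := by
    intro ω
    have h1 : ‖(ω : EuclideanSpace ℝ (Fin (n + 2)))‖ = 1 := by simpa using ω.2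
    have h2 := EuclideanSpace.norm_sq_eq (ω : EuclideanSpace ℝ (Fin (n + 2)))
    rw [h1] at h2
    simp only [Real.norm_eq_abs, sq_abs, one_pow] at h2
    simp only [pow_two] at h2
    exact_mod_cast congrArg (fun x : ℝ => (x : ℂ)) h2.symm
  -- the pointwise formula
  set P : ℕ → ℕ → Metric.sphere (0 : EuclideanSpace ℝ (Fin (n + 2))) 1 → ℂ := fun p q ω =>
    (-(starRingEnd ℂ) (zc b ω)) ^ p * (zc b ω) ^ q with hP
  set R : Fin n → Metric.sphere (0 : EuclideanSpace ℝ (Fin (n + 2))) 1 → ℂ := fun i ω =>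
    (b.repr (ω : EuclideanSpace ℝ (Fin (n + 2))) (.inr i) : ℂ) with hR
  have hPc : ∀ p q, Continuous (P p q) := by
    intro p q
    have := (continuous_zc b).comp
      (continuous_subtype_val (p := fun x => x ∈ Metric.sphere (0 : EuclideanSpace ℝ (Fin (n + 2))) 1))
    exact ((Complex.continuous_conj.comp this).neg.pow p).mul (this.pow q)
  have hRc : ∀ i, Continuous (R i) := by
    intro i
    exact Complex.continuous_ofReal.comp
      ((EuclideanSpace.proj (Sum.inr i) : EuclideanSpace ℝ (Fin 2 ⊕ Fin n) →L[ℝ] ℝ).continuous.comp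
      (b.repr.continuous.comp continuous_subtype_val))
  have hcint : ∀ f : Metric.sphere (0 : EuclideanSpace ℝ (Fin (n + 2))) 1 → ℂ, Continuous f →
      Integrable f μ := fun f hf => hf.integrable_of_hasCompactSupport (HasCompactSupport.of_compactSpace f)
  set A := φ (ι τ * ι τd) with hA
  set B := φ (ι τd * ι τ) with hB
  set C : Fin n → ℂ := fun i => φ (ι (fun j => (b (.inr i) j : ℂ)) * ι τd) with hC
  set D : Fin n → ℂ := fun i => φ (ι (fun j => (b (.inr i) j : ℂ)) * ι τ) with hD
  have key : ∀ k l : ℕ, (∫ ω : Metric.sphere (0 : EuclideanSpace ℝ (Fin (n + 2))) 1,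
          φ (((∑ j, ((ω : EuclideanSpace ℝ (Fin (n + 2))) j : ℂ) * τd j) ^ k *
              (∑ j, ((ω : EuclideanSpace ℝ (Fin (n + 2))) j : ℂ) * τ j) ^ l) •
            (ι (fun j => ((ω : EuclideanSpace ℝ (Fin (n + 2))) j : ℂ)) * ι τ * ι τd *
              ι (fun j => ((ω : EuclideanSpace ℝ (Fin (n + 2))) j : ℂ)))) ∂μ)
      = -(A * ∫ ω, P k l ω ∂μ) + (B - A) * ∫ ω, P (k + 1) (l + 1) ω ∂μ := by
    intro k l
    have hpt : ∀ ω : Metric.sphere (0 : EuclideanSpace ℝ (Fin (n + 2))) 1,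
        φ (((∑ j, ((ω : EuclideanSpace ℝ (Fin (n + 2))) j : ℂ) * τd j) ^ k *
              (∑ j, ((ω : EuclideanSpace ℝ (Fin (n + 2))) j : ℂ) * τ j) ^ l) •
            (ι (fun j => ((ω : EuclideanSpace ℝ (Fin (n + 2))) j : ℂ)) * ι τ * ι τd *
              ι (fun j => ((ω : EuclideanSpace ℝ (Fin (n + 2))) j : ℂ))))
        = (-A * P k l ω + (B - A) * P (k + 1) (l + 1) ω)
          + ∑ i, ((2 * C i) * (P k (l + 1) ω * R i ω) - (2 * D i) * (P (k + 1) l ω * R i ω)) := by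
      intro ω
      have h := Qf_pointwise (n + 2) (fun j => ((ω : EuclideanSpace ℝ (Fin (n + 2))) j : ℂ)) τ τd
        (hsph ω) hτ hτd (fun i => R i ω) (fun i j => (b (.inr i) j : ℂ)) (hdec ω)
      rw [show ι = CliffordAlgebra.ι (Qf (n + 2)) from rfl, h, hz, hw]
      simp only [map_smul, map_add, map_sum, map_sub, smul_eq_mul]
      rw [mul_add, Finset.mul_sum]
      congr 1
      · simp only [hP, hA, hB, ι]; ring
      · refine Finset.sum_congr rfl fun i _ => ?_
        simp only [hP, hC, hD, ι]; ring
    simp only [hpt]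
    have i1 : ∀ c p q, Integrable (fun ω => c * P p q ω) μ := fun c p q =>
      (hcint _ (hPc p q)).const_mul c
    have i2 : ∀ c p q i, Integrable (fun ω => c * (P p q ω * R i ω)) μ := fun c p q i =>
      (hcint _ ((hPc p q).mul (hRc i))).const_mul c
    have hT : ∀ p q i, ∫ ω, P p q ω * R i ω ∂μ = 0 := fun p q i => sph_T b p q i
    have j3 : ∀ i ∈ (Finset.univ : Finset (Fin n)), Integrable (fun ω =>
        (2 * C i) * (P k (l + 1) ω * R i ω) - (2 * D i) * (P (k + 1) l ω * R i ω)) μ :=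
      fun i _ => (i2 _ _ _ _).sub (i2 _ _ _ _)
    have j1 : Integrable (fun ω => -A * P k l ω + (B - A) * P (k + 1) (l + 1) ω) μ :=
      (i1 _ _ _).add (i1 _ _ _)
    rw [integral_add j1 (integrable_finsetSum _ j3), integral_add (i1 _ _ _) (i1 _ _ _),
      integral_finsetSum _ j3]
    simp only [integral_const_mul]
    rw [Finset.sum_eq_zero, add_zero, neg_mul]
    intro i _
    rw [integral_sub (i2 _ _ _ _) (i2 _ _ _ _), integral_const_mul, integral_const_mul, hT, hT]
    ring
  have hKne : ∀ p q, p ≠ q → ∫ ω, P p q ω ∂μ = 0 := fun p q h => sph_K_ne b p q h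
  have hK := fun k => sph_K b k
  have hwedge : (2 : ℂ) * φ wedge = A - B := by
    have := congrArg φ (Qf_wedge (n + 2) τ τd)
    rw [map_smul, map_sub, smul_eq_mul] at this
    exact this
  refine ⟨fun k l hkl => ?_, fun k => ?_⟩
  · rw [key, hKne k l hkl, hKne (k + 1) (l + 1) (by omega)]
    ring
  · rw [key]
    rw [show ∫ ω, P k k ω ∂μ = _ from hK k, show ∫ ω, P (k + 1) (k + 1) ω ∂μ = _ from hK (k + 1)]
    simp only [map_smul, map_sub, smul_eq_mul]
    rw [← hA, ← hB]
    have hg : Real.Gamma (k + 1 + ((n + 2 : ℕ) : ℝ) / 2)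
        = (k + ((n + 2 : ℕ) : ℝ) / 2) * Real.Gamma (k + ((n + 2 : ℕ) : ℝ) / 2) := by
      rw [show (k : ℝ) + 1 + ((n + 2 : ℕ) : ℝ) / 2 = (k + ((n + 2 : ℕ) : ℝ) / 2) + 1 by ring]
      exact Real.Gamma_add_one (by positivity)
    have hc : (((k + 1 : ℕ) : ℝ) + ((n + 2 : ℕ) : ℝ) / 2) = k + 1 + ((n + 2 : ℕ) : ℝ) / 2 := by
      push_cast; ring
    have hGpos : 0 < Real.Gamma (k + ((n + 2 : ℕ) : ℝ) / 2) := Real.Gamma_pos_of_pos (by positivity)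
    have hne : (k + ((n + 2 : ℕ) : ℝ) / 2) ≠ 0 := by positivity
    rw [hc]
    set X : ℝ := Real.pi ^ (((n + 2 : ℕ) : ℝ) / 2) *
      ((Nat.factorial k : ℝ) / Real.Gamma (k + 1 + ((n + 2 : ℕ) : ℝ) / 2)) with hX
    have e1 : 2 * Real.pi ^ (((n + 2 : ℕ) : ℝ) / 2) * (Nat.factorial k : ℝ)
        / Real.Gamma (k + ((n + 2 : ℕ) : ℝ) / 2) = X * (2 * k + ((n + 2 : ℕ) : ℝ)) := by
      rw [hX, hg]
      have := hGpos.ne'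
      field_simp
    have e2 : 2 * Real.pi ^ (((n + 2 : ℕ) : ℝ) / 2) * (Nat.factorial (k + 1) : ℝ)
        / Real.Gamma (k + 1 + ((n + 2 : ℕ) : ℝ) / 2) = X * (2 * (k + 1)) := by
      rw [hX, Nat.factorial_succ]
      push_cast
      ring
    rw [e1, e2]
    push_cast
    linear_combination (-2 * (-1) ^ k * (X : ℂ)) * hwedge
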